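/- Let k be a field of characteristic zero, and let (M, x_M) and (N, x_N) be pairs of vector superspaces over k with odd nilpotent endomorphisms, with Deligne filtrations 𝓕^•(M), 𝓕^•(N) and 𝓕^•(M⊗N) (for the induced odd nilpotent endomorphism on M ⊗ N). Define Gr^{ev}(M) = ⊕_{i∈ℤ} 𝓕^{2i}(M)/𝓕^{2i−1}(M), and similarly for N and M ⊗ N. Then dim_k Gr^{ev}(M⊗N) = dim_k Gr^{ev}(M) · dim_k Gr^{ev}(N). [Monoidality of the semisimplification functor Rep(𝔾_a^{(1|1)}) → Rep(OSp(1|2)), at the level of dimensions.] -/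

import Mathlib

open scoped TensorProduct

section Defs

variable (k : Type*) [Field k]

def IsEvenMap {V : Type*} [AddCommGroup V] [Module k V]
    (V0 V1 : Submodule k V) (f : V →ₗ[k] V) : Prop :=
  (∀ v ∈ V0, f v ∈ V0) ∧ (∀ v ∈ V1, f v ∈ V1)

def IsOddMap {V : Type*} [AddCommGroup V] [Module k V]
    (V0 V1 : Submodule k V) (f : V →ₗ[k] V) : Prop :=
  (∀ v ∈ V0, f v ∈ V1) ∧ (∀ v ∈ V1, f v ∈ V0)

/-- The shift endomorphism of the string module `M_n`: sends basis vector `a_j` to `a_{j+1}`,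
and `a_n` to `0`.  In coordinates, `(x f) j = f (j-1)` for `j ≥ 1` and `(x f) 0 = 0`. -/
def shiftMap (n : ℕ) : (Fin (n+1) → k) →ₗ[k] (Fin (n+1) → k) where
  toFun f := fun j =>
    if (j : ℕ) = 0 then 0 else f ⟨(j : ℕ) - 1, Nat.lt_of_le_of_lt (Nat.sub_le _ _) j.isLt⟩
  map_add' f g := by funext j; by_cases h : (j : ℕ) = 0 <;> simp only [Pi.add_apply, h, ↓reduceIte, add_zero]
  map_smul' c f := by funext j; by_cases h : (j : ℕ) = 0 <;> simp only [Pi.smul_apply, h, ↓reduceIte, smul_zero, RingHom.id_apply]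

/-- The even (`r = 0`) resp. odd (`r = 1`) part of the string module `Π^ε M_n`:
coordinates `j` with `(j + ε) % 2 = r`. -/
def stringPart (n ε r : ℕ) : Submodule k (Fin (n+1) → k) :=
  Submodule.pi Set.univ (fun j => if ((j : ℕ) + ε) % 2 = r then (⊤ : Submodule k k) else ⊥)

/-- Isomorphism of pairs (vector superspace with endomorphism): an even linear isomorphism
intertwining the endomorphisms. -/
def PairIso {V : Type*} [AddCommGroup V] [Module k V]
    (V0 V1 : Submodule k V) (x : V →ₗ[k] V)
    {W : Type*} [AddCommGroup W] [Module k W]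
    (W0 W1 : Submodule k W) (y : W →ₗ[k] W) : Prop :=
  ∃ φ : V ≃ₗ[k] W, (∀ v ∈ V0, φ v ∈ W0) ∧ (∀ v ∈ V1, φ v ∈ W1) ∧ ∀ v, φ (x v) = y (φ v)

/-- `V` decomposes as a direct sum of `x`-invariant graded subspaces, each isomorphic as a pair
to some `Π^ε M_n` with `P n`. -/
def DecomposesIntoStrings {V : Type*} [AddCommGroup V] [Module k V]
    (V0 V1 : Submodule k V) (x : V →ₗ[k] V) (P : ℕ → Prop) : Prop :=
  ∃ (m : ℕ) (U : Fin m → Submodule k V), DirectSum.IsInternal U ∧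
    ∀ i : Fin m, (U i = (U i ⊓ V0) ⊔ (U i ⊓ V1)) ∧
      ∃ (hx : ∀ v ∈ U i, x v ∈ U i) (n ε : ℕ), ε ≤ 1 ∧ P n ∧
        PairIso k (V0.comap (U i).subtype) (V1.comap (U i).subtype) (x.restrict hx)
          (stringPart k n ε 0) (stringPart k n ε 1) (shiftMap k n)

/-- A pair `(V, x)` (odd nilpotent `x`) is neat if it decomposes into strings `Π^ε M_{2s}`. -/
def IsNeat {V : Type*} [AddCommGroup V] [Module k V]
    (V0 V1 : Submodule k V) (x : V →ₗ[k] V) : Prop :=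
  DecomposesIntoStrings k V0 V1 x (fun n => Even n)

variable {V W : Type*} [AddCommGroup V] [Module k V] [AddCommGroup W] [Module k W]

/-- The set of pure tensors `v ⊗ w` with `v ∈ A`, `w ∈ B`. -/
def pureTensors (A : Submodule k V) (B : Submodule k W) : Set (V ⊗[k] W) :=
  {t | ∃ v ∈ A, ∃ w ∈ B, t = v ⊗ₜ[k] w}

/-- The even part `(V₀⊗W₀) ⊕ (V₁⊗W₁)` of the tensor product of two superspaces. -/
def tensorEven (V0 V1 : Submodule k V) (W0 W1 : Submodule k W) : Submodule k (V ⊗[k] W) :=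
  Submodule.span k (pureTensors k V0 W0 ∪ pureTensors k V1 W1)

/-- The odd part `(V₀⊗W₁) ⊕ (V₁⊗W₀)` of the tensor product of two superspaces. -/
def tensorOdd (V0 V1 : Submodule k V) (W0 W1 : Submodule k W) : Submodule k (V ⊗[k] W) :=
  Submodule.span k (pureTensors k V0 W1 ∪ pureTensors k V1 W0)

/-- `z` is the super tensor-product endomorphism induced by `x` and `y`:
`z (v ⊗ w) = x v ⊗ w + (-1)^p v ⊗ y w` for `v` homogeneous of parity `p`. -/
def IsSuperTensorMap (V0 V1 : Submodule k V) (x : V →ₗ[k] V) (y : W →ₗ[k] W)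
    (z : V ⊗[k] W →ₗ[k] V ⊗[k] W) : Prop :=
  (∀ v ∈ V0, ∀ w : W, z (v ⊗ₜ[k] w) = (x v) ⊗ₜ[k] w + v ⊗ₜ[k] (y w)) ∧
  (∀ v ∈ V1, ∀ w : W, z (v ⊗ₜ[k] w) = (x v) ⊗ₜ[k] w - v ⊗ₜ[k] (y w))

/-- Componentwise shift endomorphism on a finite direct sum of string modules. -/
def multiShift {N : ℕ} (n : Fin N → ℕ) :
    ((i : Fin N) → (Fin (n i + 1) → k)) →ₗ[k] ((i : Fin N) → (Fin (n i + 1) → k)) :=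
  LinearMap.pi (fun i => (shiftMap k (n i)).comp (LinearMap.proj i))

/-- Even/odd part of a finite direct sum of string modules `⊕ᵢ Π^{ε i} M_{n i}`. -/
def multiPart {N : ℕ} (n ε : Fin N → ℕ) (r : ℕ) :
    Submodule k ((i : Fin N) → (Fin (n i + 1) → k)) :=
  Submodule.pi Set.univ (fun i => stringPart k (n i) (ε i) r)

end Defs

/-- A **Deligne filtration** for a nilpotent endomorphism `x` of a finite-dimensional vector
space `M`. -/
structure IsDeligneFiltration (k : Type*) [Field k] {M : Type*} [AddCommGroup M] [Module k M]
    (F : ℤ → Submodule k M) (x : M →ₗ[k] M) : Prop where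
  mono : Monotone F
  eventually_bot : ∃ a : ℤ, ∀ i ≤ a, F i = ⊥
  eventually_top : ∃ b : ℤ, ∀ i : ℤ, b ≤ i → F i = ⊤
  shift : ∀ i : ℤ, ∀ v ∈ F i, x v ∈ F (i - 2)
  gr_surjective : ∀ i : ℤ, 0 ≤ i → ∀ v ∈ F (-i), ∃ u ∈ F i, v - (x ^ i.toNat) u ∈ F (-i - 1)
  gr_injective : ∀ i : ℤ, 0 ≤ i → ∀ u ∈ F i, (x ^ i.toNat) u ∈ F (-i - 1) → u ∈ F (i - 1)

/-- The dimension of `Gr^{ev}(M) = ⊕_{i∈ℤ} 𝓕^{2i}(M)/𝓕^{2i−1}(M)`: the (finitely supported)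
sum over `i : ℤ` of `dim 𝓕^{2i}(M) − dim 𝓕^{2i−1}(M)`. -/
noncomputable def grEvDim (k : Type*) [Field k] {M : Type*} [AddCommGroup M] [Module k M]
    (F : ℤ → Submodule k M) : ℕ :=
  ∑ᶠ i : ℤ, (Module.finrank k (F (2*i)) - Module.finrank k (F (2*i - 1)))


section Aux
open Module

lemma aux_rank {k V W : Type*} [Field k] [AddCommGroup V] [Module k V] [FiniteDimensional k V]
    [AddCommGroup W] [Module k W] [FiniteDimensional k W] (f : V →ₗ[k] W)
    (S S' : Submodule k V) (C D : Submodule k W) (hS : S' ≤ S) (hD : D ≤ C)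
    (h1 : ∀ s ∈ S, f s ∈ C) (h2 : ∀ s ∈ S, (f s ∈ D ↔ s ∈ S'))
    (h3 : ∀ c ∈ C, ∃ s ∈ S, c - f s ∈ D) :
    finrank k S + finrank k D = finrank k C + finrank k S' := by
  let g : S →ₗ[k] (C ⧸ D.submoduleOf C) := (D.submoduleOf C).mkQ.comp (f.restrict h1)
  have hk : LinearMap.ker g = S'.submoduleOf S := by
    ext ⟨s, hs⟩
    rw [LinearMap.mem_ker, LinearMap.comp_apply, Submodule.mkQ_apply, Submodule.Quotient.mk_eq_zero]
    exact h2 s hs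
  have hr : LinearMap.range g = ⊤ := by
    rw [LinearMap.range_eq_top]
    intro c
    obtain ⟨⟨c, hc⟩, rfl⟩ := Submodule.mkQ_surjective _ c
    obtain ⟨s, hs, h⟩ := h3 c hc
    refine ⟨⟨s, hs⟩, ?_⟩
    simp only [g, LinearMap.comp_apply, Submodule.mkQ_apply]
    symm
    rw [Submodule.Quotient.eq]
    simpa [Submodule.submoduleOf] using h
  have e1 := LinearMap.finrank_range_add_finrank_ker g
  rw [hr, hk, finrank_top, (Submodule.submoduleOfEquivOfLe hS).finrank_eq] at e1
  have e2 := Submodule.finrank_quotient_add_finrank (D.submoduleOf C)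
  rw [(Submodule.submoduleOfEquivOfLe hD).finrank_eq] at e2
  omega

section Del
variable {k V : Type*} [Field k] [AddCommGroup V] [Module k V]
  {F : ℤ → Submodule k V} {x : V →ₗ[k] V}

lemma aux_shift (h : IsDeligneFiltration k F x) (t : ℕ) (i : ℤ) (v : V) (hv : v ∈ F i) :
    (x ^ t) v ∈ F (i - 2 * t) := by
  induction t with
  | zero => simpa using hv
  | succ t ih =>
    rw [pow_succ', Module.End.mul_apply]
    have := h.shift _ _ ih
    convert this using 2
    push_cast; ring

lemma aux_nil (h : IsDeligneFiltration k F x) : ∃ n : ℕ, ∀ t : ℕ, n ≤ t → x ^ t = 0 := by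
  obtain ⟨a, ha⟩ := h.eventually_bot
  obtain ⟨b, hb⟩ := h.eventually_top
  refine ⟨(b - a).toNat, fun t ht => ?_⟩
  ext v
  have := aux_shift h t (max b a) v (by rw [hb _ (le_max_left _ _)]; trivial)
  rw [ha _ (by omega)] at this
  simpa using this

lemma aux_ker_le (h : IsDeligneFiltration k F x) (t : ℕ) (v : V) (hv : (x ^ t) v = 0) :
    v ∈ F ((t : ℤ) - 1) := by
  obtain ⟨b, hb⟩ := h.eventually_top
  have key : ∀ m : ℕ, v ∈ F ((t : ℤ) - 1 + m) → v ∈ F ((t : ℤ) - 1) := by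
    intro m
    induction m with
    | zero => simp
    | succ m ih =>
      intro hm
      apply ih
      have := h.gr_injective ((t : ℤ) + m) (by positivity) v (by convert hm using 2; push_cast; ring)
        (by
          have : ((t : ℤ) + m).toNat = m + t := by omega
          rw [this, pow_add, Module.End.mul_apply, hv, map_zero]
          exact zero_mem _)
      convert this using 2
      ring
  apply key (b - (t - 1)).toNat
  rw [hb _ (by omega)]
  trivial

lemma aux_lift (h : IsDeligneFiltration k F x) (t : ℕ) (i : ℤ) (hi : i ≤ t) (v : V)
    (hv : v ∈ F (i - 2 * t)) : ∃ u ∈ F i, (x ^ t) u = v := by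
  obtain ⟨a, ha⟩ := h.eventually_bot
  have key : ∀ m : ℕ, ∀ i : ℤ, i ≤ t → i - 2 * t ≤ a + m → ∀ v ∈ F (i - 2 * t),
      ∃ u ∈ F i, (x ^ t) u = v := by
    intro m
    induction m with
    | zero =>
      intro i hi hm v hv
      rw [ha _ (by simpa using hm)] at hv
      refine ⟨0, zero_mem _, ?_⟩
      simp at hv
      simp [hv]
    | succ m ih =>
      intro i hi hm v hv
      obtain ⟨u, hu, hvu⟩ := h.gr_surjective (2 * t - i) (by omega) v (by convert hv using 2; ring)
      have e : (2 * (t : ℤ) - i).toNat = t + (t - i).toNat := by omega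
      rw [e, pow_add, Module.End.mul_apply] at hvu
      obtain ⟨w, hw, hw2⟩ := ih (i - 1) (by omega) (by push_cast at hm; omega) _
        (by convert hvu using 2; ring)
      refine ⟨w + (x ^ (t - i).toNat) u, add_mem (h.mono (by omega) hw) ?_, ?_⟩
      · have := aux_shift h (t - i).toNat _ _ hu
        convert this using 2
        omega
      · rw [map_add, hw2]; abel
  exact key (i - 2 * t - a).toNat i hi (by omega) v hv

variable [FiniteDimensional k V]

lemma aux_sym (h : IsDeligneFiltration k F x) (i : ℕ) :
    finrank k (F i) + finrank k (F (-i - 1)) = finrank k (F (-i)) + finrank k (F (i - 1)) := by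
  apply aux_rank (x ^ i) _ _ _ _ (h.mono (by omega)) (h.mono (by omega))
  · intro s hs
    have := aux_shift h i _ _ hs
    convert this using 2
    ring
  · intro s hs
    constructor
    · intro h'
      exact h.gr_injective i (by positivity) s hs (by simpa using h')
    · intro h'
      have := aux_shift h i _ _ h'
      convert this using 2
      ring
  · intro c hc
    simpa using h.gr_surjective i (by positivity) c hc

lemma aux_kerdim (h : IsDeligneFiltration k F x) (t : ℕ) :
    finrank k (F ((t : ℤ) - 1)) = finrank k (F (-(t : ℤ) - 1)) + finrank k (LinearMap.ker (x ^ t)) := by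
  have := aux_rank (x ^ t) (F ((t : ℤ) - 1)) (LinearMap.ker (x ^ t)) (F (-(t : ℤ) - 1)) ⊥
    (fun v hv => aux_ker_le h t v hv) bot_le
    (by
      intro s hs
      have := aux_shift h t _ _ hs
      convert this using 2
      ring)
    (by intro s hs; simp)
    (by
      intro c hc
      obtain ⟨u, hu, hu2⟩ := aux_lift h t (t - 1) (by omega) c (by convert hc using 2; ring)
      exact ⟨u, hu, by simp [hu2]⟩)
  simpa using this

/-- `dim Gr^i`, as an integer -/
noncomputable def gdim (F : ℤ → Submodule k V) (i : ℤ) : ℤ :=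
  (finrank k (F i) : ℤ) - finrank k (F (i - 1))

lemma aux_gsum (h : IsDeligneFiltration k F x) (t : ℕ) :
    gdim F t + gdim F (t + 1) =
      (finrank k (LinearMap.range (x ^ t)) : ℤ) - finrank k (LinearMap.range (x ^ (t + 1))) := by
  have h1 := aux_kerdim h t
  have h2 := aux_kerdim h (t + 1)
  have h3 := aux_sym h (t + 1)
  have r1 := LinearMap.finrank_range_add_finrank_ker (x ^ t)
  have r2 := LinearMap.finrank_range_add_finrank_ker (x ^ (t + 1))
  unfold gdim
  have e1 : ((t + 1 : ℕ) : ℤ) - 1 = t := by push_cast; ring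
  have e2 : -((t + 1 : ℕ) : ℤ) = -(t : ℤ) - 1 := by push_cast; ring
  have e3 : (t : ℤ) + 1 - 1 = t := by ring
  rw [e1, e2] at h2 h3
  rw [e3]
  push_cast at *
  omega

lemma aux_gsym (h : IsDeligneFiltration k F x) (i : ℕ) : gdim F (-i) = gdim F i := by
  have := aux_sym h i
  unfold gdim
  omega

lemma aux_gzero (h : IsDeligneFiltration k F x) : ∃ n : ℕ, ∀ i : ℤ, (n : ℤ) ≤ |i| → gdim F i = 0 := by
  obtain ⟨a, ha⟩ := h.eventually_bot
  obtain ⟨b, hb⟩ := h.eventually_top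
  refine ⟨a.natAbs + b.natAbs + 1, fun i hi => ?_⟩
  unfold gdim
  rcases le_total 0 i with h0 | h0
  · rw [abs_of_nonneg h0] at hi
    rw [hb i (by omega), hb (i - 1) (by omega)]; simp
  · rw [abs_of_nonpos h0] at hi
    rw [ha i (by omega), ha (i - 1) (by omega)]; simp

lemma aux_ev (h : IsDeligneFiltration k F x) : ∃ n0 : ℕ, ∀ n : ℕ, n0 ≤ n →
    (grEvDim k F : ℤ) = gdim F 0 + ∑ i ∈ Finset.range n, 2 * gdim F (2 * (i + 1 : ℕ)) := by
  obtain ⟨n0, hn0⟩ := aux_gzero h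
  refine ⟨n0, fun n hn => ?_⟩
  have hg : ∀ i : ℤ, ((finrank k (F (2 * i)) - finrank k (F (2 * i - 1)) : ℕ) : ℤ) = gdim F (2 * i) := by
    intro i
    have := Submodule.finrank_mono (h.mono (show 2 * i - 1 ≤ 2 * i by omega))
    unfold gdim
    omega
  unfold grEvDim
  rw [finsum_eq_sum_of_support_subset (s := Finset.Icc (-(n : ℤ)) n)]
  · rw [Nat.cast_sum, Finset.sum_congr rfl (fun i _ => hg i)]
    clear hn
    induction n with
    | zero => simp
    | succ n ih =>
      rw [Finset.sum_range_succ, ← add_assoc, ← ih]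
      have : Finset.Icc (-((n + 1 : ℕ) : ℤ)) (n + 1 : ℕ) =
          insert (-((n + 1 : ℕ) : ℤ)) (insert ((n + 1 : ℕ) : ℤ) (Finset.Icc (-(n : ℤ)) n)) := by
        ext j; simp only [Finset.mem_insert, Finset.mem_Icc]; push_cast; omega
      rw [this, Finset.sum_insert, Finset.sum_insert]
      · have := aux_gsym h (2 * (n + 1))
        push_cast at this ⊢
        rw [mul_neg, this]; ring
      · simp
      · simp only [Finset.mem_insert, Finset.mem_Icc]; push_cast; omega
  · intro i hi
    simp only [Function.mem_support] at hi
    simp only [Finset.coe_Icc, Set.mem_Icc]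
    by_contra hc
    apply hi
    have := hn0 (2 * i) (by
      rcases le_total 0 i with h0 | h0
      · rw [abs_of_nonneg (by omega)]; omega
      · rw [abs_of_nonpos (by omega)]; omega)
    have := hg i
    omega

end Del
end Aux

section Count
open Module
variable {k V : Type*} [Field k] [AddCommGroup V] [Module k V] [FiniteDimensional k V]

/-- splitting data relative to an idempotent `R`. -/
structure SplitData (ε x R P e θ : Module.End k V) : Prop where
  idem : P * P = P
  left : R * P = P
  right : P * R = P
  px : P * x = x * P
  pe : P * ε = ε * P
  comm : e * x ^ 2 - x ^ 2 * e = -(x * P)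
  anti : θ * x + x * θ = R - P
  odd : θ * ε = -(ε * θ)

lemma aux_convex (x : Module.End k V) (P : Module.End k V) (t : ℕ)
    (H : ∀ v w, (x ^ (t + 1) * P) v = (x ^ (t + 2) * P) w → ∃ u, (x ^ t * P) v = (x ^ (t + 1) * P) u)
    (hP : P * x = x * P) :
    finrank k (LinearMap.range (x ^ t * P)) + finrank k (LinearMap.range (x ^ (t + 2) * P)) =
      finrank k (LinearMap.range (x ^ (t + 1) * P)) + finrank k (LinearMap.range (x ^ (t + 1) * P)) := by
  have hc : ∀ t, x ^ (t + 1) * P = x ^ t * P * x := by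
    intro t; rw [pow_succ, mul_assoc, mul_assoc, hP]
  have hl : ∀ t, x ^ (t + 1) * P = x * (x ^ t * P) := by
    intro t; rw [pow_succ', mul_assoc]
  have hle : ∀ t, LinearMap.range (x ^ (t + 1) * P) ≤ LinearMap.range (x ^ t * P) := by
    rintro t _ ⟨v, rfl⟩
    exact ⟨x v, by rw [hc]; rfl⟩
  apply aux_rank x _ _ _ _ (hle t) (hle (t + 1))
  · rintro _ ⟨v, rfl⟩
    exact ⟨v, by rw [hl]; rfl⟩
  · rintro _ ⟨v, rfl⟩
    constructor
    · rintro ⟨w, hw⟩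
      obtain ⟨u, hu⟩ := H v w (by rw [hw, hl]; rfl)
      exact ⟨u, hu.symm⟩
    · rintro ⟨w, hw⟩
      refine ⟨w, ?_⟩
      rw [← hw, hl (t + 1)]; rfl
  · rintro _ ⟨v, rfl⟩
    refine ⟨(x ^ t * P) v, ⟨v, rfl⟩, ?_⟩
    rw [hl t, Module.End.mul_apply x, sub_self]
    exact zero_mem _

variable {ε x P e θ : Module.End k V}

lemma aux_comm_pow (h : SplitData ε x 1 P e θ) (j : ℕ) :
    e * x ^ (2 * (j + 1)) = x ^ (2 * (j + 1)) * e - ((j + 1 : ℕ) : Module.End k V) * (x ^ (2 * j + 1) * P) := by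
  have hc : e * x ^ 2 = x ^ 2 * e - x * P := by
    have := h.comm
    rw [sub_eq_iff_eq_add] at this
    rw [this]; abel
  have hPx : ∀ n, P * x ^ n = x ^ n * P := fun n => (Commute.pow_right (show Commute P x from h.px) n).eq
  induction j with
  | zero => simp [hc]
  | succ j ih =>
    rw [show 2 * (j + 1 + 1) = 2 * (j + 1) + 2 by ring, pow_add, ← mul_assoc, ih, sub_mul, mul_assoc,
      hc, mul_sub, mul_assoc _ _ (x ^ 2), mul_assoc _ P (x ^ 2), hPx, ← mul_assoc _ _ P, ← mul_assoc _ _ P,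
      ← pow_add, ← pow_succ, ← mul_assoc]
    push_cast
    rw [show 2 * j + 1 + 2 = 2 * (j + 1) + 1 by ring]
    noncomm_ring

lemma aux_P_convex [CharZero k] (h : SplitData ε x 1 P e θ) (j : ℕ) :
    finrank k (LinearMap.range (x ^ (2 * j + 1) * P)) + finrank k (LinearMap.range (x ^ (2 * j + 1 + 2) * P)) =
      finrank k (LinearMap.range (x ^ (2 * j + 1 + 1) * P)) + finrank k (LinearMap.range (x ^ (2 * j + 1 + 1) * P)) := by
  apply aux_convex _ _ _ _ h.px
  intro v w hvw
  have hPx : ∀ n, P * x ^ n = x ^ n * P := fun n => (Commute.pow_right (show Commute P x from h.px) n).eq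
  have e0 := aux_comm_pow h j
  rw [show 2 * (j + 1) = 2 * j + 1 + 1 by ring] at e0
  -- apply `P * e` to the hypothesis
  have e1 : P * e * (x ^ (2 * j + 1 + 1) * P) = x ^ (2 * j + 1 + 1) * P * (e * P)
      - ((j + 1 : ℕ) : Module.End k V) * (x ^ (2 * j + 1) * P) := by
    rw [← mul_assoc, mul_assoc P e, e0, mul_sub, ← (Nat.cast_commute (j+1) P).left_comm, ← mul_assoc P, ← mul_assoc P, hPx, hPx, sub_mul]
    simp only [mul_assoc, h.idem]
  have e2 : P * e * (x ^ (2 * j + 1 + 2) * P) = x ^ (2 * j + 1 + 1) * P * (e * x * P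
      - ((j + 1 : ℕ) : Module.End k V)) := by
    have : x ^ (2 * j + 1 + 2) * P = (x ^ (2 * j + 1 + 1) * P) * (x * P) := by
      rw [mul_assoc, ← mul_assoc P, h.px, mul_assoc, h.idem, ← mul_assoc, ← pow_succ]
    rw [this, ← mul_assoc, e1, sub_mul, mul_sub]
    congr 1
    · simp only [mul_assoc]
      rw [← mul_assoc P x P, h.px, mul_assoc, h.idem]
    · rw [mul_assoc, mul_assoc, ← mul_assoc P x P, h.px, mul_assoc, h.idem, ← mul_assoc (x ^ _), ← pow_succ, (Nat.cast_commute (j+1) _).eq]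
  have e3 := congrArg (P * e) hvw
  rw [← Module.End.mul_apply, ← Module.End.mul_apply, e1, e2] at e3
  have hj : ((j + 1 : ℕ) : k) ≠ 0 := by exact_mod_cast Nat.succ_ne_zero j
  refine ⟨((j + 1 : ℕ) : k)⁻¹ • ((e * P) v - (e * x * P - ((j + 1 : ℕ) : Module.End k V)) w), ?_⟩
  rw [map_smul, map_sub, ← Module.End.mul_apply, ← Module.End.mul_apply _ _ w, ← e3]
  rw [LinearMap.sub_apply, sub_sub_cancel, Module.End.mul_apply (((j + 1 : ℕ) : Module.End k V)), Module.End.natCast_apply]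
  rw [← Nat.cast_smul_eq_nsmul k, smul_smul, inv_mul_cancel₀ hj, one_smul]

lemma aux_Q_convex (h : SplitData ε x 1 P e θ) (j : ℕ) :
    finrank k (LinearMap.range (x ^ (2 * j) * (1 - P))) + finrank k (LinearMap.range (x ^ (2 * j + 2) * (1 - P))) =
      finrank k (LinearMap.range (x ^ (2 * j + 1) * (1 - P))) + finrank k (LinearMap.range (x ^ (2 * j + 1) * (1 - P))) := by
  have ha := h.anti
  have hp := h.px
  have hi := h.idem
  obtain ⟨Q, hQ⟩ : ∃ Q, Q = 1 - P := ⟨_, rfl⟩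
  have hQx : Q * x = x * Q := by rw [hQ, sub_mul, mul_sub, hp, one_mul, mul_one]
  have hQQ : Q * Q = Q := by rw [hQ, sub_mul, mul_sub, mul_sub, hi]; simp
  rw [← hQ] at ha ⊢
  have hQn : ∀ n, Q * x ^ n = x ^ n * Q := fun n => (Commute.pow_right (show Commute Q x from hQx) n).eq
  have hθ1 : θ * x = Q - x * θ := by rw [← ha]; abel
  have hθ2 : θ * x ^ 2 = x ^ 2 * θ := by
    rw [pow_two, ← mul_assoc, hθ1, sub_mul, mul_assoc, hθ1, mul_sub, hQx, mul_assoc]; abel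
  have hθn : θ * x ^ (2 * j) = x ^ (2 * j) * θ := by
    rw [pow_mul]; exact (Commute.pow_right (show Commute θ (x ^ 2) from hθ2) j).eq
  apply aux_convex _ _ _ _ hQx
  intro v w hvw
  have e1 : Q * θ * (x ^ (2 * j + 1) * Q) = x ^ (2 * j) * Q - x ^ (2 * j + 1) * Q * (θ * Q) := by
    rw [pow_succ]
    calc _ = Q * (θ * x ^ (2 * j)) * x * Q := by simp only [mul_assoc]
      _ = (Q * x ^ (2 * j)) * (θ * x) * Q := by rw [hθn]; simp only [mul_assoc]
      _ = x ^ (2 * j) * (Q * Q) * Q - x ^ (2 * j) * (Q * x) * θ * Q := by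
        rw [hQn, hθ1]; noncomm_ring
      _ = _ := by rw [hQQ, mul_assoc _ Q Q, hQQ, hQx]; simp only [mul_assoc]
  have e2 : Q * θ * (x ^ (2 * j + 2) * Q) = x ^ (2 * j + 1) * Q * (x * (θ * Q)) := by
    rw [pow_add]
    calc _ = Q * (θ * x ^ (2 * j)) * x ^ 2 * Q := by simp only [mul_assoc]
      _ = (Q * x ^ (2 * j)) * (θ * x ^ 2) * Q := by rw [hθn]; simp only [mul_assoc]
      _ = x ^ (2 * j) * (Q * x) * x * θ * Q := by
        rw [hQn, hθ2, pow_two]; simp only [mul_assoc]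
      _ = _ := by rw [hQx, pow_succ]; simp only [mul_assoc]
  have e3 := congrArg (Q * θ) hvw
  rw [← Module.End.mul_apply, ← Module.End.mul_apply, e1, e2, LinearMap.sub_apply, sub_eq_iff_eq_add,
    Module.End.mul_apply (x ^ (2 * j + 1) * Q) (x * (θ * Q)),
    Module.End.mul_apply (x ^ (2 * j + 1) * Q) (θ * Q), ← map_add] at e3
  exact ⟨_, e3⟩

lemma aux_range_add (h : SplitData ε x 1 P e θ) (t : ℕ) :
    finrank k (LinearMap.range (x ^ t)) =
      finrank k (LinearMap.range (x ^ t * P)) + finrank k (LinearMap.range (x ^ t * (1 - P))) := by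
  have hPx : P * x ^ t = x ^ t * P := (Commute.pow_right (show Commute P x from h.px) t).eq
  have := aux_rank P (LinearMap.range (x ^ t)) (LinearMap.range (x ^ t * (1 - P)))
    (LinearMap.range (x ^ t * P)) ⊥
    (by rintro _ ⟨v, rfl⟩; exact ⟨(1 - P) v, rfl⟩) bot_le
    (by rintro _ ⟨v, rfl⟩; exact ⟨v, by rw [← hPx]; rfl⟩)
    (by
      rintro _ ⟨v, rfl⟩
      rw [Submodule.mem_bot, ← Module.End.mul_apply, hPx]
      constructor
      · intro h'
        exact ⟨v, by rw [mul_sub, LinearMap.sub_apply, h', mul_one, sub_zero]⟩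
      · rintro ⟨w, hw⟩
        rw [← hPx, Module.End.mul_apply, ← hw, ← Module.End.mul_apply, ← mul_assoc, hPx, mul_assoc, mul_sub, h.idem]
        simp)
    (by
      rintro _ ⟨v, rfl⟩
      refine ⟨(x ^ t) (P v), ⟨_, rfl⟩, ?_⟩
      rw [Submodule.mem_bot, ← Module.End.mul_apply P, hPx, Module.End.mul_apply _ P (P v), ← Module.End.mul_apply P P, h.idem]
      simp)
  simpa using this

theorem aux_count [CharZero k] (h : SplitData ε x 1 P e θ) {F : ℤ → Submodule k V}
    (hF : IsDeligneFiltration k F x) : grEvDim k F = finrank k (LinearMap.range P) := by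
  obtain ⟨a, ha⟩ : ∃ a : ℕ → ℤ, ∀ t, a t = finrank k (LinearMap.range (x ^ t * P)) := ⟨_, fun _ => rfl⟩
  obtain ⟨b, hb⟩ : ∃ b : ℕ → ℤ, ∀ t, b t = finrank k (LinearMap.range (x ^ t * (1 - P))) := ⟨_, fun _ => rfl⟩
  have hA : ∀ j, a (2 * j + 1) + a (2 * j + 3) = 2 * a (2 * j + 2) := by
    intro j
    have := aux_P_convex h j
    rw [show 2 * j + 1 + 2 = 2 * j + 3 by ring, show 2 * j + 1 + 1 = 2 * j + 2 by ring] at this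
    simp only [ha]; omega
  have hB : ∀ j, b (2 * j) + b (2 * j + 2) = 2 * b (2 * j + 1) := by
    intro j
    have := aux_Q_convex h j
    simp only [hb]; omega
  have hg : ∀ t : ℕ, gdim F t + gdim F (t + 1 : ℕ) = a t - a (t + 1) + (b t - b (t + 1)) := by
    intro t
    have h0 := aux_gsum hF t
    have h1 := aux_range_add h t
    have h2 := aux_range_add h (t + 1)
    simp only [ha, hb]
    push_cast at h0 ⊢
    omega
  obtain ⟨n1, hn1⟩ := aux_nil hF
  obtain ⟨n2, hn2⟩ := aux_gzero hF
  obtain ⟨n3, hn3⟩ := aux_ev hF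
  have ha0 : ∀ t, n1 ≤ t → a t = 0 := by
    intro t ht; rw [ha, hn1 t ht]; simp
  have hb0 : ∀ t, n1 ≤ t → b t = 0 := by
    intro t ht; rw [hb, hn1 t ht]; simp
  have key : ∀ m i : ℕ, n1 + n2 ≤ i + m → gdim F (2 * i : ℕ) = a (2 * i) - a (2 * i + 1) := by
    intro m
    induction m with
    | zero =>
      intro i hi
      rw [ha0 _ (by omega), ha0 _ (by omega), hn2 _ (by rw [abs_of_nonneg (by positivity)]; push_cast; omega)]
      rfl
    | succ m ih =>
      intro i hi
      have h1 := ih (i + 1) (by omega)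
      have h2 := hg (2 * i)
      have h3 := hg (2 * i + 1)
      have h4 := hA i
      have h5 := hB i
      rw [show 2 * (i + 1) = 2 * i + 2 by ring] at h1
      rw [show 2 * i + 1 + 1 = 2 * i + 2 by ring] at h3
      rw [show 2 * i + 2 + 1 = 2 * i + 3 by ring] at h1
      linarith
  have hgk : ∀ i : ℕ, gdim F (2 * i : ℕ) = a (2 * i) - a (2 * i + 1) :=
    fun i => key (n1 + n2) i (by omega)
  have hsum : ∀ n : ℕ, gdim F 0 + ∑ i ∈ Finset.range n, 2 * gdim F (2 * (i + 1 : ℕ)) = a 0 - a (2 * n + 1) := by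
    intro n
    induction n with
    | zero => simpa using hgk 0
    | succ n ih =>
      rw [Finset.sum_range_succ, ← add_assoc, ih]
      have h1 := hgk (n + 1)
      have h4 := hA n
      rw [show 2 * (n + 1) = 2 * n + 2 by ring] at h1 ⊢
      rw [show 2 * n + 2 + 1 = 2 * n + 3 by ring] at h1 ⊢
      have : (2 * ((n + 1 : ℕ) : ℤ)) = ((2 * n + 2 : ℕ) : ℤ) := by push_cast; ring
      rw [this]
      linarith
  have := hn3 (n1 + n3) (by omega)
  rw [hsum, ha0 (2 * (n1 + n3) + 1) (by omega), ha, pow_zero, one_mul] at this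
  simpa using this

end Count

section Exist
open Module
variable {k V : Type*} [Field k] [AddCommGroup V] [Module k V]

lemma aux_eps_pow {ε x : Module.End k V} (hx : ε * x = -(x * ε)) (i : ℕ) (v : V) :
    ε ((x ^ i) v) = (-1 : k) ^ i • (x ^ i) (ε v) := by
  induction i with
  | zero => simp
  | succ i ih =>
    have h : ∀ w, ε (x w) = -(x (ε w)) := fun w => by
      have := congrArg (fun f => f w) hx
      simpa using this
    rw [pow_succ', Module.End.mul_apply, h, ih, map_smul, pow_succ, Module.End.mul_apply]
    simp

lemma aux_dual {x : Module.End k V} {n : ℕ} {v : V} (h1 : (x ^ n) v ≠ 0)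
    (h2 : ∀ i, n < i → (x ^ i) v = 0) :
    ∃ φ : V →ₗ[k] k, ∀ i, φ ((x ^ i) v) = if i = n then 1 else 0 := by
  have key : ∀ m, m ≤ n → ∃ φ : V →ₗ[k] k, φ ((x ^ n) v) = 1 ∧ ∀ i, n - m ≤ i → i < n → φ ((x ^ i) v) = 0 := by
    intro m
    induction m with
    | zero =>
      intro _
      obtain ⟨f, hf⟩ := Module.Projective.exists_dual_ne_zero k h1
      refine ⟨(f ((x ^ n) v))⁻¹ • f, by simp [hf], fun i _ _ => by omega⟩
    | succ m ih =>
      intro hm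
      obtain ⟨φ, hφ, h⟩ := ih (by omega)
      refine ⟨φ - (φ ((x ^ (n - (m + 1))) v)) • (φ ∘ₗ (x ^ (m + 1))), ?_, ?_⟩
      · simp only [LinearMap.sub_apply, LinearMap.smul_apply, LinearMap.comp_apply, hφ]
        rw [← Module.End.mul_apply, ← pow_add, h2 (m + 1 + n) (by omega)]
        simp
      · intro i hi hin
        simp only [LinearMap.sub_apply, LinearMap.smul_apply, LinearMap.comp_apply]
        rw [← Module.End.mul_apply, ← pow_add]
        rcases Nat.eq_or_lt_of_le hi with rfl | hlt
        · rw [show m + 1 + (n - (m + 1)) = n by omega, hφ]; simp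
        · rw [h2 (m + 1 + i) (by omega), h i (by omega) hin]; simp
  obtain ⟨φ, hφ, h⟩ := key n le_rfl
  refine ⟨φ, fun i => ?_⟩
  split_ifs with hi
  · rw [hi, hφ]
  · rcases Nat.lt_or_gt_of_ne hi with hlt | hgt
    · exact h i (by omega) hlt
    · rw [h2 i hgt, map_zero]

lemma aux_string [CharZero k] {ε x R : Module.End k V} (hε : ε * ε = 1) (hx : ε * x = -(x * ε))
    (hR : R * R = R) (hRx : R * x = x * R) (hRe : R * ε = ε * R) {n : ℕ}
    (h1 : x ^ n * R ≠ 0) (h2 : x ^ (n + 1) * R = 0) :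
    ∃ (v : V) (φ : V →ₗ[k] k) (s : k), R v = v ∧ (∀ w, φ (R w) = φ w) ∧ s * s = 1 ∧ ε v = s • v ∧
      (∀ w, φ (ε w) = ((-1) ^ n * s) * φ w) ∧ (∀ i, φ ((x ^ i) v) = if i = n then 1 else 0) ∧
      (∀ w, (x ^ (n + 1)) (R w) = 0) := by
  have hεε : ∀ w, ε (ε w) = w := fun w => by
    have := congrArg (fun f => f w) hε
    simpa using this
  have hRR : ∀ w, R (R w) = R w := fun w => by
    have := congrArg (fun f => f w) hR
    simpa using this
  have hRε : ∀ w, R (ε w) = ε (R w) := fun w => by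
    have := congrArg (fun f => f w) hRe
    simpa using this
  have hRxn : ∀ i w, R ((x ^ i) w) = (x ^ i) (R w) := fun i w => by
    have := congrArg (fun f => f w) ((Commute.pow_right (show Commute R x from hRx) i).eq)
    simpa using this
  have hx0 : ∀ w, (x ^ (n + 1)) (R w) = 0 := fun w => by
    have := congrArg (fun f => f w) h2
    simpa using this
  obtain ⟨w, hw⟩ : ∃ w, (x ^ n) (R w) ≠ 0 := by
    by_contra hc
    push Not at hc
    exact h1 (by ext w; simpa using hc w)
  obtain ⟨v, s, hv, hs, hvs, hvn⟩ : ∃ (v : V) (s : k), R v = v ∧ s * s = 1 ∧ ε v = s • v ∧ (x ^ n) v ≠ 0 := by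
    by_cases hc : (x ^ n) (R w + ε (R w)) = 0
    · refine ⟨R w - ε (R w), -1, ?_, by norm_num, ?_, ?_⟩
      · rw [map_sub, hRε, hRR]
      · rw [map_sub, hεε]; module
      · intro hd
        apply hw
        have : (2 : k) • (x ^ n) (R w) = 0 := by
          rw [← map_smul, show (2 : k) • R w = (R w + ε (R w)) + (R w - ε (R w)) by module, map_add, hc, hd, add_zero]
        exact (smul_eq_zero.mp this).resolve_left two_ne_zero
    · refine ⟨R w + ε (R w), 1, ?_, by norm_num, ?_, hc⟩
      · rw [map_add, hRε, hRR]
      · rw [map_add, hεε]; module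
  obtain ⟨φ, hφ⟩ := aux_dual hvn (fun i hi => by
    rw [show i = (i - (n + 1)) + (n + 1) by omega, pow_add, Module.End.mul_apply, ← hv, hx0, map_zero])
  have hsn : ((-1 : k) ^ n * s) * ((-1) ^ n * s) = 1 := by
    rw [mul_mul_mul_comm, hs, ← mul_pow]; simp
  refine ⟨v, (2 : k)⁻¹ • ((φ + ((-1 : k) ^ n * s) • (φ ∘ₗ ε)) ∘ₗ R), s, hv, ?_, hs, hvs, ?_, ?_, hx0⟩
  · intro u
    simp [hRR]
  · intro u
    simp only [LinearMap.smul_apply, LinearMap.comp_apply, LinearMap.add_apply, hRε, hεε, smul_eq_mul]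
    linear_combination (-(2 : k)⁻¹ * φ (ε (R u))) * hsn
  · intro i
    simp only [LinearMap.smul_apply, LinearMap.comp_apply, LinearMap.add_apply, hRxn, hv, smul_eq_mul]
    rw [aux_eps_pow hx, hvs, map_smul, map_smul, map_smul, hφ]
    split_ifs with h
    · subst h
      simp only [smul_eq_mul, mul_one]
      have : (2 : k) ≠ 0 := two_ne_zero
      field_simp
      linear_combination hsn
    · simp

lemma aux_step [CharZero k] {ε x R : Module.End k V} (hε : ε * ε = 1) (hx : ε * x = -(x * ε))
    (hR : R * R = R) (hRx : R * x = x * R) (hRe : R * ε = ε * R) {n : ℕ}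
    (h1 : x ^ n * R ≠ 0) (h2 : x ^ (n + 1) * R = 0) :
    ∃ S D : Module.End k V, S ≠ 0 ∧ S * S = S ∧ R * S = S ∧ S * R = S ∧ S * x = x * S ∧ S * ε = ε * S ∧
      ((D * x ^ 2 - x ^ 2 * D = -(x * S)) ∨ (D * x + x * D = S ∧ D * ε = -(ε * D))) := by
  obtain ⟨v, φ, s, hv, hφR, hs, hvs, hφε, hφ, hx0⟩ := aux_string hε hx hR hRx hRe h1 h2
  have hRxn : ∀ i w, R ((x ^ i) w) = (x ^ i) (R w) := fun i w => by
    have := congrArg (fun f => f w) ((Commute.pow_right (show Commute R x from hRx) i).eq)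
    simpa using this
  let E : ℕ → ℕ → Module.End k V := fun a b => (φ ∘ₗ (x ^ b)).smulRight ((x ^ a) v)
  have hE : ∀ a b w, E a b w = φ ((x ^ b) w) • (x ^ a) v := fun a b w => rfl
  have hxE : ∀ a b, x * E a b = E (a + 1) b := by
    intro a b; ext w
    rw [Module.End.mul_apply, hE, hE, map_smul, pow_succ', Module.End.mul_apply]
  have hEx : ∀ a b, E a b * x = E a (b + 1) := by
    intro a b; ext w
    rw [Module.End.mul_apply, hE, hE, pow_succ, Module.End.mul_apply]
  have hE1 : ∀ b, E (n + 1) b = 0 := by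
    intro b; ext w
    rw [hE, ← hv, hx0]; simp
  have hE2 : ∀ a, E a (n + 1) = 0 := by
    intro a; ext w
    rw [hE, ← hφR, hRxn, hx0]; simp
  have hEE : ∀ a b c d, E a b * E c d = if b + c = n then E a d else 0 := by
    intro a b c d; ext w
    rw [Module.End.mul_apply, hE, hE, map_smul, map_smul, ← Module.End.mul_apply, ← pow_add, hφ]
    split_ifs <;> simp [hE]
  have hEε : ∀ a b, E a b * ε = ((-1 : k) ^ b * ((-1) ^ n * s)) • E a b := by
    intro a b; ext w
    rw [Module.End.mul_apply, LinearMap.smul_apply, hE, hE]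
    have := aux_eps_pow hx b w
    have h' : (x ^ b) (ε w) = (-1 : k) ^ b • ε ((x ^ b) w) := by
      rw [this, smul_smul, ← mul_pow]; simp
    rw [h', map_smul, hφε, smul_smul, smul_eq_mul, ← mul_assoc]
  have hεE : ∀ a b, ε * E a b = ((-1 : k) ^ a * s) • E a b := by
    intro a b; ext w
    rw [Module.End.mul_apply, LinearMap.smul_apply, hE, map_smul, aux_eps_pow hx, hvs, map_smul]
    module
  have hRE : ∀ a b, R * E a b = E a b := by
    intro a b; ext w
    rw [Module.End.mul_apply, hE, map_smul, hRxn, hv]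
  have hER : ∀ a b, E a b * R = E a b := by
    intro a b; ext w
    rw [Module.End.mul_apply, hE, hE, ← hRxn, hφR]
  obtain ⟨S, hS⟩ : ∃ S, S = ∑ a ∈ Finset.range (n + 1), E a (n - a) := ⟨_, rfl⟩
  have hxS : x * S = ∑ a ∈ Finset.range (n + 1), E (a + 1) (n - a) := by
    rw [hS, Finset.mul_sum]; exact Finset.sum_congr rfl fun a _ => hxE _ _
  have hSx : S * x = x * S := by
    rw [hxS, Finset.sum_range_succ, Nat.sub_self, hE1, hS, Finset.sum_range_succ', add_mul, hEx, Nat.sub_zero, hE2,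
      Finset.sum_mul]
    congr 1
    refine Finset.sum_congr rfl fun a ha => ?_
    rw [hEx]
    congr 1
    have := Finset.mem_range.mp ha
    omega
  have hSS : S * S = S := by
    rw [hS, Finset.sum_mul]
    refine Finset.sum_congr rfl fun a ha => ?_
    rw [Finset.mul_sum]
    have := Finset.mem_range.mp ha
    rw [Finset.sum_eq_single a]
    · rw [hEE, if_pos (by omega)]
    · intro b _ hb
      rw [hEE, if_neg (by omega)]
    · intro h; exact absurd ha h
  have hS0 : S ≠ 0 := by
    intro h0
    have h3 : E n n = 0 := by
      have : S * E n n = E n n := by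
        rw [hS, Finset.sum_mul, Finset.sum_eq_single n]
        · rw [hEE, if_pos (by omega)]
        · intro b hb hbn
          have := Finset.mem_range.mp hb
          rw [hEE, if_neg (by omega)]
        · simp
      rw [← this, h0, zero_mul]
    have h4 := congrArg (fun f => φ (f v)) h3
    simp [hE, hφ] at h4
  -- raising operators
  have hD : ∀ d : ℕ → k, d 0 = 0 → d (n + 1) = 0 →
      let D := ∑ a ∈ Finset.range n, d (a + 1) • E a (n - 1 - a)
      D * x = ∑ a ∈ Finset.range (n + 1), d (a + 1) • E a (n - a) ∧
      x * D = ∑ a ∈ Finset.range (n + 1), d a • E a (n - a) := by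
    intro d d0 dn D
    constructor
    · rw [Finset.sum_range_succ, dn, zero_smul, add_zero, Finset.sum_mul]
      refine Finset.sum_congr rfl fun a ha => ?_
      have := Finset.mem_range.mp ha
      rw [smul_mul_assoc, hEx, show n - 1 - a + 1 = n - a by omega]
    · rw [Finset.sum_range_succ', d0, zero_smul, add_zero, Finset.mul_sum]
      refine Finset.sum_congr rfl fun a ha => ?_
      rw [mul_smul_comm, hxE, show n - 1 - a = n - (a + 1) by omega]
  refine ⟨S, ?_⟩
  have hcommon : S ≠ 0 ∧ S * S = S ∧ R * S = S ∧ S * R = S ∧ S * x = x * S ∧ S * ε = ε * S := by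
    refine ⟨hS0, hSS, ?_, ?_, hSx, ?_⟩
    · rw [hS, Finset.mul_sum]; exact Finset.sum_congr rfl fun a _ => hRE _ _
    · rw [hS, Finset.sum_mul]; exact Finset.sum_congr rfl fun a _ => hER _ _
    · rw [hS, Finset.sum_mul, Finset.mul_sum]
      refine Finset.sum_congr rfl fun a ha => ?_
      have := Finset.mem_range.mp ha
      obtain ⟨b, rfl⟩ : ∃ b, n = a + b := ⟨n - a, by omega⟩
      rw [hεE, hEε, Nat.add_sub_cancel_left]
      congr 1
      rw [pow_add, show (-1 : k) ^ b * ((-1) ^ a * (-1) ^ b * s) = ((-1) ^ b * (-1) ^ b) * ((-1) ^ a * s) by ring,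
        ← mul_pow]
      simp
  obtain ⟨c1, c2, c3, c4, c5, c6⟩ := hcommon
  rcases Nat.even_or_odd' n with ⟨m, hm | hm⟩
  · -- even `n`
    let d : ℕ → k := fun a => if a % 2 = 0 then -((a / 2 : ℕ) : k) else (m : k) - ((a / 2 : ℕ) : k)
    have hd : ∀ a, d (a + 2) = d a - 1 := by
      intro a
      simp only [d, show (a + 2) % 2 = a % 2 by omega, show (a + 2) / 2 = a / 2 + 1 by omega]
      split_ifs <;> push_cast <;> ring
    have d0 : d 0 = 0 := by simp [d]
    have dn : d (n + 1) = 0 := by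
      simp only [d, hm, show (2 * m + 1) % 2 = 1 by omega, show (2 * m + 1) / 2 = m by omega]
      simp
    obtain ⟨hDx, hxD⟩ := hD d d0 dn
    refine ⟨∑ a ∈ Finset.range n, d (a + 1) • E a (n - 1 - a), c1, c2, c3, c4, c5, c6, Or.inl ?_⟩
    rw [pow_two, ← mul_assoc, hDx, mul_assoc x x, hxD, hxS, Finset.sum_mul, Finset.mul_sum]
    have e1 : ∑ a ∈ Finset.range (n + 1), d (a + 1) • E a (n - a) * x =
        ∑ a ∈ Finset.range (n + 1), d (a + 2) • E (a + 1) (n - a) := by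
      rw [Finset.sum_range_succ', Finset.sum_range_succ, Nat.sub_self, hE1, smul_mul_assoc, Nat.sub_zero, hEx, hE2,
        smul_zero, smul_zero]
      congr 1
      refine Finset.sum_congr rfl fun a ha => ?_
      have := Finset.mem_range.mp ha
      rw [smul_mul_assoc, hEx, show n - (a + 1) + 1 = n - a by omega]
    rw [e1, ← Finset.sum_sub_distrib, ← Finset.sum_neg_distrib]
    refine Finset.sum_congr rfl fun a ha => ?_
    rw [mul_smul_comm, hxE, hd]
    module
  · -- odd `n`
    let d : ℕ → k := fun a => if a % 2 = 0 then 0 else 1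
    have hd : ∀ a, d (a + 1) + d a = 1 := by
      intro a
      simp only [d]
      rcases Nat.mod_two_eq_zero_or_one a with h | h
      · simp [h, show (a + 1) % 2 = 1 by omega]
      · simp [h, show (a + 1) % 2 = 0 by omega]
    have d0 : d 0 = 0 := by simp [d]
    have dn : d (n + 1) = 0 := by
      simp only [d, hm, show (2 * m + 1 + 1) % 2 = 0 by omega]
      simp
    obtain ⟨hDx, hxD⟩ := hD d d0 dn
    refine ⟨∑ a ∈ Finset.range n, d (a + 1) • E a (n - 1 - a), c1, c2, c3, c4, c5, c6, Or.inr ⟨?_, ?_⟩⟩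
    · rw [hDx, hxD, hS, ← Finset.sum_add_distrib]
      refine Finset.sum_congr rfl fun a ha => ?_
      rw [← add_smul, hd, one_smul]
    · rw [Finset.sum_mul, Finset.mul_sum, ← Finset.sum_neg_distrib]
      refine Finset.sum_congr rfl fun a ha => ?_
      have := Finset.mem_range.mp ha
      rw [smul_mul_assoc, mul_smul_comm, ← smul_neg]
      congr 1
      obtain ⟨b, hb⟩ : ∃ b, n = a + b + 1 := ⟨n - 1 - a, by omega⟩
      rw [hεE, hEε, show n - 1 - a = b by omega, hb, ← neg_smul]
      congr 1
      rw [pow_succ, pow_add, show (-1 : k) ^ b * ((-1) ^ a * (-1) ^ b * -1 * s) = -(((-1) ^ b * (-1) ^ b) * ((-1) ^ a * s)) by ring,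
        ← mul_pow]
      simp

lemma aux_exists [CharZero k] [FiniteDimensional k V] {ε x : Module.End k V} (hε : ε * ε = 1)
    (hx : ε * x = -(x * ε)) (hnil : IsNilpotent x) :
    ∀ (m : ℕ) (R : Module.End k V), R * R = R → R * x = x * R → R * ε = ε * R →
      finrank k (LinearMap.range R) ≤ m → ∃ P e θ, SplitData ε x R P e θ := by
  intro m
  have hzero : ∃ P e θ, SplitData ε x 0 P e θ := ⟨0, 0, 0, by constructor <;> simp⟩
  induction m with
  | zero =>
    intro R _ _ _ h0
    have : R = 0 := by
      rw [← LinearMap.range_eq_bot]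
      exact Submodule.finrank_eq_zero.mp (by omega)
    rw [this]; exact hzero
  | succ m ih =>
    intro R hR hRx hRe hm
    by_cases hR0 : R = 0
    · rw [hR0]; exact hzero
    obtain ⟨n, h1, h2⟩ : ∃ n, x ^ n * R ≠ 0 ∧ x ^ (n + 1) * R = 0 := by
      classical
      have hex : ∃ n, x ^ n * R = 0 := by
        obtain ⟨n, hn⟩ := hnil
        exact ⟨n, by rw [hn, zero_mul]⟩
      have hpos : Nat.find hex ≠ 0 := by
        intro h
        have := Nat.find_spec hex
        rw [h] at this
        exact hR0 (by simpa using this)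
      refine ⟨Nat.find hex - 1, Nat.find_min hex (by omega), ?_⟩
      rw [Nat.sub_add_cancel (by omega)]
      exact Nat.find_spec hex
    obtain ⟨S, D, c1, c2, c3, c4, c5, c6, c7⟩ := aux_step hε hx hR hRx hRe h1 h2
    have hRS : (R - S) * (R - S) = R - S := by
      simp only [mul_sub, sub_mul, hR, c2, c3, c4]; abel
    obtain ⟨P, e, θ, hd⟩ := ih (R - S) hRS
      (by simp only [mul_sub, sub_mul, hRx, c5]) (by simp only [mul_sub, sub_mul, hRe, c6])
      (by
        have hlt : LinearMap.range (R - S) < LinearMap.range R := by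
          refine lt_of_le_of_ne ?_ ?_
          · rintro _ ⟨w, rfl⟩
            refine ⟨(R - S) w, ?_⟩
            rw [← Module.End.mul_apply, mul_sub, hR, c3]
          · intro heq
            obtain ⟨w, hw⟩ : ∃ w, S w ≠ 0 := by
              by_contra hc
              push Not at hc
              exact c1 (by ext w; simpa using hc w)
            have : S w ∈ LinearMap.range (R - S) := by
              rw [heq, ← c3]; exact ⟨S w, rfl⟩
            obtain ⟨u, hu⟩ := this
            apply hw
            have h3 : S * (R - S) = 0 := by rw [mul_sub, c4, c2, sub_self]
            rw [← c2, Module.End.mul_apply, ← hu, ← Module.End.mul_apply, h3]; rfl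
        have := Submodule.finrank_lt_finrank_of_lt hlt
        omega)
    have hPS : P * S = 0 := by rw [← hd.right, mul_assoc, sub_mul, c3, c2, sub_self, mul_zero]
    have hSP : S * P = 0 := by rw [← hd.left, ← mul_assoc, mul_sub, c4, c2, sub_self, zero_mul]
    have hRP : R * P = P := by
      have := hd.left; rw [sub_mul, hSP, sub_zero] at this; exact this
    have hPR : P * R = P := by
      have := hd.right; rw [mul_sub, hPS, sub_zero] at this; exact this
    rcases c7 with c7 | ⟨c7, c8⟩
    · refine ⟨P + S, e + D, θ, ?_⟩
      constructor
      · simp only [add_mul, mul_add, hd.idem, hPS, hSP, c2]; abel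
      · rw [mul_add, hRP, c3]
      · rw [add_mul, hPR, c4]
      · rw [add_mul, mul_add, hd.px, c5]
      · rw [add_mul, mul_add, hd.pe, c6]
      · rw [add_mul, mul_add, mul_add, neg_add, ← hd.comm, ← c7]; abel
      · rw [hd.anti]; abel
      · exact hd.odd
    · refine ⟨P, e, θ + D, ?_⟩
      constructor
      · exact hd.idem
      · exact hRP
      · exact hPR
      · exact hd.px
      · exact hd.pe
      · exact hd.comm
      · have := hd.anti
        rw [add_mul, mul_add, show θ * x + D * x + (x * θ + x * D) = (θ * x + x * θ) + (D * x + x * D) by abel,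
          this, c7]; abel
      · rw [add_mul, mul_add, neg_add, hd.odd, c8]

end Exist

section Tens
open Module
variable {k M N : Type*} [Field k] [AddCommGroup M] [Module k M] [AddCommGroup N] [Module k N]

lemma aux_map_mul (f g : Module.End k M) (f' g' : Module.End k N) :
    (TensorProduct.map f f' * TensorProduct.map g g' : Module.End k (M ⊗[k] N)) =
      TensorProduct.map (f * g) (f' * g') := (TensorProduct.map_mul _ _ _ _).symm

lemma aux_tensor {ε x P e θ : Module.End k M} {ε' y P' e' θ' : Module.End k N}
    (hε : ε * ε = 1) (hx : ε * x = -(x * ε))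
    (h : SplitData ε x 1 P e θ) (h' : SplitData ε' y 1 P' e' θ') :
    ∃ E T : Module.End k (M ⊗[k] N), SplitData 0 (TensorProduct.map x 1 + TensorProduct.map ε y) 1
      (TensorProduct.map P P') E T := by
  have hx' : x * ε + ε * x = 0 := by rw [hx]; simp
  have hxx : ε * (x * x) = x * x * ε := by
    rw [← mul_assoc, hx, neg_mul, mul_assoc, hx]; simp [mul_assoc]
  have hzz : (TensorProduct.map x 1 + TensorProduct.map ε y : Module.End k (M ⊗[k] N)) ^ 2 =
      TensorProduct.map (x * x) 1 + TensorProduct.map 1 (y * y) := by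
    rw [pow_two, add_mul, mul_add, mul_add]
    simp only [aux_map_mul, one_mul, mul_one, hε]
    have : (TensorProduct.map (x * ε) y + TensorProduct.map (ε * x) y : Module.End k (M ⊗[k] N)) = 0 := by
      rw [← TensorProduct.map_add_left, hx', TensorProduct.map_zero_left]
    rw [add_assoc, ← add_assoc (TensorProduct.map (x * ε) y), this, zero_add]
  have hPxx : P * (x * x) = x * x * P := by rw [← mul_assoc, h.px, mul_assoc, h.px, mul_assoc]
  have hPyy : P' * (y * y) = y * y * P' := by rw [← mul_assoc, h'.px, mul_assoc, h'.px, mul_assoc]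
  have hc : e * (x * x) + x * P = x * x * e := by
    have := h.comm; rw [pow_two, sub_eq_iff_eq_add] at this; rw [this]; abel
  have hc' : e' * (y * y) + y * P' = y * y * e' := by
    have := h'.comm; rw [pow_two, sub_eq_iff_eq_add] at this; rw [this]; abel
  have ha : θ * x + x * θ + P = 1 := by rw [h.anti]; abel
  have ha' : θ' * y + y * θ' + P' = 1 := by rw [h'.anti]; abel
  have ho : θ * ε + ε * θ = 0 := by rw [h.odd]; simp
  refine ⟨TensorProduct.map e P' + TensorProduct.map (ε * P) e',
    TensorProduct.map θ 1 + TensorProduct.map (P * ε) θ', ?_⟩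
  constructor
  · rw [aux_map_mul, h.idem, h'.idem]
  · simp
  · simp
  · rw [mul_add, add_mul]
    simp only [aux_map_mul, h.px, h'.px, h.pe, one_mul, mul_one]
  · simp
  · rw [hzz]
    rw [sub_eq_iff_eq_add, neg_add_eq_sub, eq_sub_iff_add_eq]
    simp only [add_mul, mul_add, aux_map_mul, one_mul, mul_one]
    rw [hPyy, ← hc, ← hc', TensorProduct.map_add_left, TensorProduct.map_add_right,
      mul_assoc ε P, hPxx, ← mul_assoc ε, hxx, mul_assoc (x * x)]
    abel
  · rw [eq_sub_iff_add_eq]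
    simp only [add_mul, mul_add, aux_map_mul, one_mul, mul_one]
    have i1 : (TensorProduct.map (θ * ε) y + TensorProduct.map (ε * θ) y : Module.End k (M ⊗[k] N)) = 0 := by
      rw [← TensorProduct.map_add_left, ho, TensorProduct.map_zero_left]
    have i2 : (TensorProduct.map (P * ε * x) θ' + TensorProduct.map (x * (P * ε)) θ' : Module.End k (M ⊗[k] N)) = 0 := by
      rw [← TensorProduct.map_add_left, ← mul_assoc x, ← h.px, mul_assoc, mul_assoc, ← mul_add, add_comm, hx', mul_zero,
        TensorProduct.map_zero_left]
    have i3 : (TensorProduct.map P (θ' * y) + TensorProduct.map P (y * θ') + TensorProduct.map P P' : Module.End k (M ⊗[k] N))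
        = TensorProduct.map P 1 := by
      rw [← TensorProduct.map_add_right, ← TensorProduct.map_add_right, ha']
    have i4 : (TensorProduct.map (θ * x) 1 + TensorProduct.map (x * θ) 1 + TensorProduct.map P 1 : Module.End k (M ⊗[k] N))
        = 1 := by
      rw [← TensorProduct.map_add_left, ← TensorProduct.map_add_left, ha]; exact TensorProduct.map_one
    have i5 : P * ε * ε = P := by rw [mul_assoc, hε, mul_one]
    have i6 : ε * (P * ε) = P := by rw [h.pe, ← mul_assoc, hε, one_mul]
    rw [i5, i6]
    calc _ = (TensorProduct.map (θ * x) 1 + TensorProduct.map (x * θ) 1 +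
          (TensorProduct.map P (θ' * y) + TensorProduct.map P (y * θ') + TensorProduct.map P P'))
          + (TensorProduct.map (θ * ε) y + TensorProduct.map (ε * θ) y)
          + (TensorProduct.map (P * ε * x) θ' + TensorProduct.map (x * (P * ε)) θ') := by abel
      _ = _ := by rw [i1, i2, i3, i4]; simp
  · simp

lemma aux_trace {W : Type*} [AddCommGroup W] [Module k W] [FiniteDimensional k W] (Q : Module.End k W)
    (hQ : Q * Q = Q) : LinearMap.trace k W Q = finrank k (LinearMap.range Q) :=
  LinearMap.IsProj.trace ⟨fun w => ⟨w, rfl⟩, by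
    rintro _ ⟨w, rfl⟩; rw [← Module.End.mul_apply, hQ]⟩

lemma aux_rank_tensor [CharZero k] [FiniteDimensional k M] [FiniteDimensional k N]
    {P : Module.End k M} {P' : Module.End k N} (h : P * P = P) (h' : P' * P' = P') :
    finrank k (LinearMap.range (TensorProduct.map P P')) =
      finrank k (LinearMap.range P) * finrank k (LinearMap.range P') := by
  have h1 := aux_trace (k := k) (TensorProduct.map P P') (by rw [aux_map_mul, h, h'])
  rw [LinearMap.trace_tensorProduct', aux_trace P h, aux_trace P' h'] at h1
  exact_mod_cast h1.symm

lemma aux_parity (M0 M1 : Submodule k M) (hc : IsCompl M0 M1) (x : M →ₗ[k] M) (hx : IsOddMap k M0 M1 x) :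
    ∃ ε : Module.End k M, (∀ v ∈ M0, ε v = v) ∧ (∀ v ∈ M1, ε v = -v) ∧ ε * ε = 1 ∧ ε * x = -(x * ε) := by
  have hsum : ∀ v : M, ∃ a ∈ M0, ∃ b ∈ M1, a + b = v := fun v =>
    Submodule.mem_sup.mp (by rw [hc.sup_eq_top]; trivial)
  let ε : Module.End k M := LinearMap.ofIsCompl hc M0.subtype (-M1.subtype)
  have h0 : ∀ v ∈ M0, ε v = v := fun v hv => by
    simpa [ε] using LinearMap.ofIsCompl_apply_left hc (φ := M0.subtype) (ψ := -M1.subtype) ⟨v, hv⟩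
  have h1 : ∀ v ∈ M1, ε v = -v := fun v hv => by
    simpa [ε] using LinearMap.ofIsCompl_apply_right hc (φ := M0.subtype) (ψ := -M1.subtype) ⟨v, hv⟩
  refine ⟨ε, h0, h1, ?_, ?_⟩
  · apply LinearMap.ext
    intro v
    obtain ⟨a, ha, b, hb, rfl⟩ := hsum v
    simp [h0 a ha, h1 b hb]
  · apply LinearMap.ext
    intro v
    obtain ⟨a, ha, b, hb, rfl⟩ := hsum v
    simp [h0 a ha, h1 b hb, h1 _ (hx.1 a ha), h0 _ (hx.2 b hb)]
    abel

end Tens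

/-- **Monoidality of the semisimplification functor at the level of dimensions**:
`dim Gr^{ev}(M⊗N) = dim Gr^{ev}(M) · dim Gr^{ev}(N)` for the Deligne filtrations of odd
nilpotent endomorphisms on superspaces `M`, `N` and of the induced endomorphism on `M ⊗ N`. -/
theorem grEvDim_tensor {k : Type*} [Field k] [CharZero k]
    (M : Type*) [AddCommGroup M] [Module k M] [FiniteDimensional k M]
    (M0 M1 : Submodule k M) (hcM : IsCompl M0 M1)
    (xM : M →ₗ[k] M) (hxModd : IsOddMap k M0 M1 xM) (hxMnil : IsNilpotent xM)
    (N : Type*) [AddCommGroup N] [Module k N] [FiniteDimensional k N]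
    (N0 N1 : Submodule k N) (hcN : IsCompl N0 N1)
    (xN : N →ₗ[k] N) (hxNodd : IsOddMap k N0 N1 xN) (hxNnil : IsNilpotent xN)
    (z : M ⊗[k] N →ₗ[k] M ⊗[k] N) (hz : IsSuperTensorMap k M0 M1 xM xN z)
    (FM : ℤ → Submodule k M) (hFM : IsDeligneFiltration k FM xM)
    (FN : ℤ → Submodule k N) (hFN : IsDeligneFiltration k FN xN)
    (FT : ℤ → Submodule k (M ⊗[k] N)) (hFT : IsDeligneFiltration k FT z) :
    grEvDim k FT = grEvDim k FM * grEvDim k FN := by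
  obtain ⟨ε, he0, he1, hε, hx⟩ := aux_parity M0 M1 hcM xM hxModd
  obtain ⟨ε', -, -, hε', hy⟩ := aux_parity N0 N1 hcN xN hxNodd
  obtain ⟨P, e, θ, h⟩ := aux_exists hε hx hxMnil _ 1 (by simp) (by simp) (by simp) le_rfl
  obtain ⟨P', e', θ', h'⟩ := aux_exists hε' hy hxNnil _ 1 (by simp) (by simp) (by simp) le_rfl
  obtain ⟨E, T, hT⟩ := aux_tensor hε hx h h'
  have hzeq : z = TensorProduct.map xM 1 + TensorProduct.map ε xN := by
    apply TensorProduct.ext'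
    intro v w
    obtain ⟨a, ha, b, hb, rfl⟩ := Submodule.mem_sup.mp
      (show v ∈ M0 ⊔ M1 by rw [hcM.sup_eq_top]; trivial)
    rw [TensorProduct.add_tmul, map_add, map_add, hz.1 a ha, hz.2 b hb]
    simp only [LinearMap.add_apply, TensorProduct.map_tmul, Module.End.one_apply, he0 a ha, he1 b hb,
      TensorProduct.neg_tmul]
    abel
  rw [← hzeq] at hT
  rw [aux_count hT hFT, aux_count h hFM, aux_count h' hFN, aux_rank_tensor h.idem h'.idem]
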